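/- For every integer r ≥ 2, the packing chromatic number of the generalised H-graph H^5(r) equals 6. -/

import Mathlib

/-- A packing `k`-colouring of a simple graph `G`: every vertex gets a colour in
`{1, …, k}` and any two distinct vertices sharing a colour `i` are at distance
greater than `i` in `G` (i.e. every walk joining them has length greater than `i`). -/
def IsPackingColoring {V : Type*} (G : SimpleGraph V) (k : ℕ) (π : V → ℕ) : Prop :=
  (∀ v, 1 ≤ π v ∧ π v ≤ k) ∧
    ∀ u v : V, u ≠ v → π u = π v → ∀ p : G.Walk u v, π u < p.length

/-- The packing chromatic number of `G`: the least `k` admitting a packing `k`-colouring. -/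
noncomputable def packingChromaticNumber {V : Type*} (G : SimpleGraph V) : ℕ :=
  sInf {k | ∃ π : V → ℕ, IsPackingColoring G k π}

/-- The generalised H-graph `H^ℓ(r)` with `ℓ` levels: vertices `uⁱⱼ = (i, j)` for
`i : Fin (ℓ+2)` and `j : ZMod (2*r)`; the outer cycles are on levels `0` and `ℓ+1`,
level `i` (`1 ≤ i ≤ ℓ`) carries the matching edges `uⁱ₂ⱼuⁱ₂ⱼ₊₁` (`0 ≤ j ≤ r-1`),
and `uⁱⱼ` is joined to `uⁱ⁺¹ⱼ` for `0 ≤ i ≤ ℓ`. -/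
def genHgraph (ℓ r : ℕ) : SimpleGraph (Fin (ℓ + 2) × ZMod (2 * r)) :=
  SimpleGraph.fromRel (fun x y =>
    (∃ j : ZMod (2 * r), x = ((0 : Fin (ℓ + 2)), j) ∧ y = ((0 : Fin (ℓ + 2)), j + 1)) ∨
    (∃ j : ZMod (2 * r), x = (Fin.last (ℓ + 1), j) ∧ y = (Fin.last (ℓ + 1), j + 1)) ∨
    (∃ i : Fin (ℓ + 2), ∃ j : ℕ, 1 ≤ (i : ℕ) ∧ (i : ℕ) ≤ ℓ ∧ j < r ∧
      x = (i, ((2 * j : ℕ) : ZMod (2 * r))) ∧ y = (i, ((2 * j + 1 : ℕ) : ZMod (2 * r)))) ∨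
    (∃ i : Fin (ℓ + 2), ∃ j : ZMod (2 * r), (i : ℕ) ≤ ℓ ∧ x = (i, j) ∧ y = (i + 1, j)))

namespace GenHgraph

open SimpleGraph

/-! ### Exhaustive search on bit masks

A set of natural numbers is stored as a bit mask. A finite graph is a list of pairs `(d, M)`, each
standing for the edges `v — v + d` with `v ∈ M`. -/

/-- `k n`, with `n` in weak head normal form when it is substituted into `k`. -/
def withValue {α : Type*} (n : ℕ) (k : ℕ → α) : α :=
  match n with
  | 0 => k 0
  | m + 1 => k m.succ

@[simp]
theorem withValue_eq {α : Type*} (n : ℕ) (k : ℕ → α) : withValue n k = k n := by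
  cases n <;> rfl

/-- The closed neighbourhood of the set `S`. -/
def grow (E : List (ℕ × ℕ)) (S : ℕ) : ℕ :=
  E.foldl (fun R e => R ||| (((S &&& e.2) <<< e.1) ||| ((S >>> e.1) &&& e.2))) S

/-- The vertex to branch on, given one mask of excluded vertices per colour: a vertex of `live` with
no colour left, failing that one with a single colour left, then one with two colours left.
The masks `k₀`, `k₁`, `k₂` hold the vertices with 0, 1, 2 colours left so far. -/
def pick (live : ℕ) : List ℕ → ℕ → ℕ → ℕ → ℕ
  | [], k₀, k₁, k₂ =>
    if k₀ ≠ 0 then k₀.log2 else if k₁ ≠ 0 then k₁.log2 else if k₂ ≠ 0 then k₂.log2 else live.log2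
  | F :: Fs, k₀, k₁, k₂ =>
    withValue (k₀ &&& F) fun l₀ =>
      withValue ((k₀ ^^^ l₀) ||| (k₁ &&& F)) fun l₁ =>
        withValue ((k₁ ^^^ (k₁ &&& F)) ||| (k₂ &&& F)) fun l₂ => pick live Fs l₀ l₁ l₂

/-- The exclusion masks that result from giving `v` each of the colours still allowed at `v`;
`S` is the ball around `v` whose radius is one less than the first colour. -/
def children (E : List (ℕ × ℕ)) (v : ℕ) : List ℕ → ℕ → List (List ℕ)
  | [], _ => []
  | F :: Fs, S =>
    withValue (grow E S) fun S' =>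
      let L := (children E v Fs S').map (F :: ·)
      if F.testBit v then L else withValue (F ||| (S' ^^^ 1 <<< v)) fun F' => (F' :: Fs) :: L

/-- Search for a packing colouring of the vertices below `N` avoiding the exclusion masks `F`;
the value `true` certifies that there is none. -/
def refute (E : List (ℕ × ℕ)) (N : ℕ) : ℕ → List ℕ → ℕ → Bool
  | 0, _, _ => false
  | n + 1, F, live =>
    withValue (pick live F live 0 0 % N) fun v =>
      withValue (live ^^^ 1 <<< v) fun live' =>
        (children E v F (1 <<< v)).all fun F' => refute E N n F' live'

theorem testBit_grow_of_testBit (E : List (ℕ × ℕ)) {S u : ℕ} (h : S.testBit u = true) :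
    (grow E S).testBit u = true := by
  suffices H : ∀ R : ℕ, R.testBit u = true → (E.foldl (fun R e =>
      R ||| (((S &&& e.2) <<< e.1) ||| ((S >>> e.1) &&& e.2))) R).testBit u = true from H S h
  induction E with
  | nil => exact fun R hR => hR
  | cons e E ih => exact fun R hR => ih _ (by simp [hR])

section Soundness

variable {V : Type*} {G : SimpleGraph V} {f : ℕ → V} {E : List (ℕ × ℕ)}

theorem testBit_or_exists_adj_of_testBit_grow
    (hE : ∀ e ∈ E, ∀ v, e.2.testBit v = true → G.Adj (f v) (f (v + e.1)))
    {S u : ℕ} (h : (grow E S).testBit u = true) :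
    S.testBit u = true ∨ ∃ w, S.testBit w = true ∧ G.Adj (f w) (f u) := by
  suffices H : ∀ R : ℕ, (E.foldl (fun R e =>
      R ||| (((S &&& e.2) <<< e.1) ||| ((S >>> e.1) &&& e.2))) R).testBit u = true →
      R.testBit u = true ∨ ∃ w, S.testBit w = true ∧ G.Adj (f w) (f u) from H S h
  clear h
  induction E with
  | nil => exact fun R hR => .inl hR
  | cons e E ih =>
    intro R hR
    rcases ih (fun e' he' => hE e' (List.mem_cons_of_mem _ he')) _ hR with h | h
    · simp only [Nat.testBit_or, Nat.testBit_and, Nat.testBit_shiftLeft, Nat.testBit_shiftRight,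
        Bool.or_eq_true, Bool.and_eq_true, decide_eq_true_eq] at h
      rcases h with h | ⟨hle, hS, hM⟩ | ⟨hS, hM⟩
      · exact .inl h
      · refine .inr ⟨u - e.1, hS, ?_⟩
        have := hE e List.mem_cons_self _ hM
        rwa [Nat.sub_add_cancel hle] at this
      · refine .inr ⟨e.1 + u, hS, ?_⟩
        rw [add_comm]
        exact (hE e List.mem_cons_self _ hM).symm
    · exact .inr h

/-- No vertex `f u` with `u < N` has a colour whose mask contains `u`; the masks in the list belong
to the colours `c, c + 1, …`. -/
def Excludes (f : ℕ → V) (N : ℕ) (π : V → ℕ) : ℕ → List ℕ → Prop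
  | _, [] => True
  | c, F :: Fs => (∀ u < N, F.testBit u = true → π (f u) ≠ c) ∧ Excludes f N π (c + 1) Fs

theorem exists_mem_children {k N : ℕ} {π : V → ℕ} (hπ : IsPackingColoring G k π)
    (hE : ∀ e ∈ E, ∀ v, e.2.testBit v = true → G.Adj (f v) (f (v + e.1)))
    (hf : ∀ u < N, ∀ v < N, f u = f v → u = v) {v : ℕ} (hv : v < N) (F : List ℕ) :
    ∀ S c : ℕ, S.testBit v = true →
      (∀ u, S.testBit u = true → ∃ p : G.Walk (f v) (f u), p.length ≤ c) →
      Excludes f N π (c + 1) F → c + 1 ≤ π (f v) → π (f v) ≤ c + F.length →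
      ∃ F' ∈ children E v F S, F'.length = F.length ∧ Excludes f N π (c + 1) F' := by
  induction F with
  | nil =>
    intro S c _ _ _ h₁ h₂
    simp at h₂
    omega
  | cons F Fs ih =>
    intro S c hvS hS hF h₁ h₂
    obtain ⟨hF, hFs⟩ := hF
    have hS' : ∀ u, (grow E S).testBit u = true →
        ∃ p : G.Walk (f v) (f u), p.length ≤ c + 1 := by
      intro u hu
      rcases testBit_or_exists_adj_of_testBit_grow hE hu with h | ⟨w, hw, hadj⟩
      · obtain ⟨p, hp⟩ := hS u h
        exact ⟨p, by omega⟩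
      · obtain ⟨p, hp⟩ := hS w hw
        exact ⟨p.concat hadj, by rw [Walk.length_concat]; omega⟩
    have hvS' := testBit_grow_of_testBit E hvS
    rw [List.length_cons] at h₂
    rcases h₁.eq_or_lt with hc | hc
    · have hFv : F.testBit v ≠ true := fun h => hF v hv h hc.symm
      refine ⟨(F ||| (grow E S ^^^ 1 <<< v)) :: Fs, by simp [children, hFv], rfl, ?_, hFs⟩
      intro u hu hbit hcu
      rw [Nat.testBit_or, Bool.or_eq_true] at hbit
      rcases hbit with hbit | hbit
      · exact hF u hu hbit hcu
      · have huv : u ≠ v := by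
          rintro rfl
          simp [Nat.testBit_xor, hvS'] at hbit
        have hbit : (grow E S).testBit u = true := by
          have h1 : (1 <<< v).testBit u = false := by
            rw [Nat.one_shiftLeft, Nat.testBit_two_pow_of_ne huv.symm]
          simpa [Nat.testBit_xor, h1] using hbit
        obtain ⟨p, hp⟩ := hS' u hbit
        have := hπ.2 (f v) (f u) (fun h => huv (hf v hv u hu h).symm) (by omega) p
        omega
    · obtain ⟨F', hmem, hlen, hex⟩ := ih (grow E S) (c + 1) hvS' hS' hFs hc (by omega)
      refine ⟨F :: F', ?_, by simp [hlen], hF, hex⟩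
      by_cases hFv : F.testBit v = true <;> simp [children, hFv, hmem]

theorem not_excludes_of_refute {k N : ℕ} {π : V → ℕ} (hπ : IsPackingColoring G k π)
    (hE : ∀ e ∈ E, ∀ v, e.2.testBit v = true → G.Adj (f v) (f (v + e.1)))
    (hf : ∀ u < N, ∀ v < N, f u = f v → u = v) (hN : 0 < N) (n : ℕ) :
    ∀ (F : List ℕ) (live : ℕ), refute E N n F live = true → k ≤ F.length →
      ¬ Excludes f N π 1 F := by
  induction n with
  | zero => simp [refute]
  | succ n ih =>
    intro F live h hk hF
    simp only [refute, withValue_eq, List.all_eq_true] at h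
    set v := pick live F live 0 0 % N
    have hv : v < N := Nat.mod_lt _ hN
    have h1 : ∀ u, (1 <<< v).testBit u = true → u = v := by
      intro u hu
      rw [Nat.one_shiftLeft, Nat.testBit_two_pow] at hu
      exact (by simpa using hu : v = u).symm
    obtain ⟨F', hmem, hlen, hex⟩ := exists_mem_children hπ hE hf hv F (1 <<< v) 0
      (by rw [Nat.one_shiftLeft, Nat.testBit_two_pow_self])
      (fun u hu => by obtain rfl := h1 u hu; exact ⟨.nil, le_rfl⟩) hF (hπ.1 _).1
      (by rw [zero_add]; exact (hπ.1 _).2.trans hk)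
    exact ih F' _ (h F' hmem) (hk.trans_eq hlen.symm) hex

end Soundness

/-! ### The strip covering `H⁵(r)` -/

/-- Adjacency of `(i, x)` and `(i', x')` in the strip `{0, …, 6} × ℤ` that covers `H⁵(r)`, up to
interchanging the two. -/
def StripLink (i : ℕ) (x : ℤ) (i' : ℕ) (x' : ℤ) : Prop :=
  (x = x' ∧ i' = i + 1) ∨ (i = i' ∧ x' = x + 1 ∧ (i = 0 ∨ i = 6 ∨ x % 2 = 0))

theorem exists_stripLink_of_adj {r : ℕ} {u w : Fin 7 × ZMod (2 * r)}
    (h : (genHgraph 5 r).Adj u w) {x : ℤ} (hx : (x : ZMod (2 * r)) = u.2) :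
    ∃ x' : ℤ, (x' : ZMod (2 * r)) = w.2 ∧
      (StripLink u.1 x w.1 x' ∨ StripLink w.1 x' u.1 x) := by
  have hpar : ∀ j : ℕ, (x : ZMod (2 * r)) = (j : ZMod (2 * r)) → x % 2 = j % 2 := by
    intro j hj
    have hj' : (x : ZMod (2 * r)) = ((j : ℤ) : ZMod (2 * r)) := by rw [hj, Int.cast_natCast]
    rw [ZMod.intCast_eq_intCast_iff] at hj'
    push_cast at hj'
    exact hj'.of_mul_right _
  have hsucc : ∀ i : Fin 7, (i : ℕ) ≤ 5 → ((i + 1 : Fin 7) : ℕ) = i + 1 := by decide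
  obtain ⟨-, h | h⟩ := h <;>
    rcases h with ⟨j, rfl, rfl⟩ | ⟨j, rfl, rfl⟩ | ⟨i, j, -, -, -, rfl, rfl⟩ | ⟨i, j, hi, rfl, rfl⟩
  · exact ⟨x + 1, by push_cast; rw [hx], .inl (.inr ⟨rfl, rfl, .inl rfl⟩)⟩
  · exact ⟨x + 1, by push_cast; rw [hx], .inl (.inr ⟨rfl, rfl, .inr (.inl rfl)⟩)⟩
  · have := hpar _ hx
    exact ⟨x + 1, by push_cast; rw [hx]; push_cast; rfl,
      .inl (.inr ⟨rfl, rfl, .inr (.inr (by omega))⟩)⟩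
  · exact ⟨x, hx, .inl (.inl ⟨rfl, hsucc i hi⟩)⟩
  · exact ⟨x - 1, by push_cast; rw [hx]; simp, .inr (.inr ⟨rfl, by ring, .inl rfl⟩)⟩
  · exact ⟨x - 1, by push_cast; rw [hx]; simp, .inr (.inr ⟨rfl, by ring, .inr (.inl rfl)⟩)⟩
  · have := hpar _ hx
    exact ⟨x - 1, by push_cast; rw [hx]; simp, .inr (.inr ⟨rfl, by ring, .inr (.inr (by omega))⟩)⟩
  · exact ⟨x, hx, .inr (.inl ⟨rfl, hsucc i hi⟩)⟩

theorem adj_of_stripLink {r : ℕ} (hr : 2 ≤ r) {i i' : Fin 7} {x x' : ℤ}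
    (h : StripLink i x i' x') :
    (genHgraph 5 r).Adj (i, (x : ZMod (2 * r))) (i', (x' : ZMod (2 * r))) := by
  have : Fact (1 < 2 * r) := ⟨by omega⟩
  rcases h with ⟨rfl, hi⟩ | ⟨hi, rfl, h⟩
  · obtain rfl : i' = i + 1 := by revert i i'; decide
    refine ⟨by simp, .inl (.inr (.inr (.inr ⟨i, _, ?_, rfl, rfl⟩)))⟩
    have := (i + 1).isLt
    omega
  · obtain rfl := Fin.ext hi
    refine ⟨by simp, .inl ?_⟩
    by_cases h0 : i = 0
    · exact .inl ⟨x, by rw [h0], by rw [h0]; push_cast; rfl⟩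
    by_cases h6 : i = 6
    · exact .inr (.inl ⟨x, by rw [h6]; rfl, by rw [h6]; push_cast; rfl⟩)
    have hi0 : (i : ℕ) ≠ 0 := fun h => h0 (Fin.ext h)
    have hi6 : (i : ℕ) ≠ 6 := fun h => h6 (Fin.ext h)
    have hr0 : (r : ℤ) ≠ 0 := by omega
    have hj : (((2 * (x / 2 % r).toNat : ℕ) : ℤ) : ZMod (2 * r)) = x := by
      rw [ZMod.intCast_eq_intCast_iff]
      push_cast
      rw [Int.toNat_of_nonneg (Int.emod_nonneg _ hr0)]
      have hx2 : x = 2 * (x / 2) := by omega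
      conv_rhs => rw [hx2]
      exact (Int.mod_modEq _ _).mul_left'
    rw [Int.cast_natCast] at hj
    refine .inr (.inr (.inl ⟨i, (x / 2 % r).toNat, by omega, by omega, ?_, by rw [hj], ?_⟩))
    · have := Int.emod_lt_of_pos (x / 2) (show (0 : ℤ) < r by omega)
      omega
    · rw [Nat.cast_add, hj]
      push_cast
      rfl

/-- The distance between `(i, x)` and `(i', y)` in the strip. -/
def stripDist (i : ℕ) (x : ℤ) (i' : ℕ) (y : ℤ) : ℤ :=
  if x / 2 = y / 2 then |(i : ℤ) - i'| + |x - y| else |x - y| + min (i + i' : ℤ) (12 - i - i')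

theorem stripDist_le_add_one {i i' j : ℕ} {x x' y : ℤ} (hi : i ≤ 6) (hi' : i' ≤ 6) (hj : j ≤ 6)
    (h : StripLink i x i' x' ∨ StripLink i' x' i x) :
    stripDist i x j y ≤ stripDist i' x' j y + 1 := by
  unfold StripLink at h
  simp only [stripDist, abs_eq_max_neg]
  split_ifs <;> omega

theorem exists_stripDist_le_length {r : ℕ} {u v : Fin 7 × ZMod (2 * r)}
    (p : (genHgraph 5 r).Walk u v) {x : ℤ} (hx : (x : ZMod (2 * r)) = u.2) :
    ∃ y : ℤ, (y : ZMod (2 * r)) = v.2 ∧ stripDist u.1 x v.1 y ≤ p.length := by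
  induction p generalizing x with
  | nil => exact ⟨x, hx, by simp [stripDist]⟩
  | @cons u w v h p ih =>
    obtain ⟨x', hx', hlink⟩ := exists_stripLink_of_adj h hx
    obtain ⟨y, hy, hle⟩ := ih hx'
    refine ⟨y, hy, ?_⟩
    have := stripDist_le_add_one (y := y) (Nat.le_of_lt_succ u.1.isLt)
      (Nat.le_of_lt_succ w.1.isLt) (Nat.le_of_lt_succ v.1.isLt) hlink
    rw [Walk.length_cons]
    push_cast
    omega

/-! ### A packing 6-colouring -/

/-- The tiles, each a colouring of two joined columns: the digit of weight `10 ^ (2 * i + q)` is the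
colour at level `i` of column `q`. Tiles 0–2, 3–6, 7–11 and 12–13 form words of length 3, 4, 5
and 2. -/
def tiles : List ℕ :=
  [21136112511341, 41132115611231, 51132641321521,
    21136412511341, 41132115611231, 31126113411251, 51123114621321,
    21136112511341, 31142113511231, 21154112311621, 16413215211431, 52134112611521,
    21153112611421, 31146213211531]

/-- The colour of tile `s` at level `i` of column `q`. -/
def tileColour (s i q : ℕ) : ℕ := tiles.getD s 0 / 10 ^ (2 * i + q) % 10

/-- The tiles that may stand to the right of tile `s`: words of length 3, 4, 5 can be concatenated
freely, the word of length 2 only with itself. -/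
def nextTiles (s : ℕ) : List ℕ :=
  if s = 2 ∨ s = 6 ∨ s = 11 then [0, 3, 7] else if s = 13 then [12] else [s + 1]

/-- The tile in position `a < r` of a cyclic arrangement of `r` tiles: words of length 3,
the last of them replaced by one of length 4 or 5 according to `r % 3`. -/
def tileAt (r a : ℕ) : ℕ :=
  if r = 2 then 12 + a
  else if a + (3 + r % 3) < r then a % 3
  else (if r % 3 = 0 then 0 else if r % 3 = 1 then 3 else 7) + (a + (3 + r % 3) - r)

theorem tileAt_lt {r a : ℕ} (ha : a < r) : tileAt r a < 14 := by
  unfold tileAt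
  split_ifs <;> omega

theorem tileAt_succ_mem {r a : ℕ} (hr : 2 ≤ r) (ha : a < r) :
    tileAt r ((a + 1) % r) ∈ nextTiles (tileAt r a) := by
  have h : (a + 1) % r = if a + 1 = r then 0 else a + 1 := by
    split_ifs with h
    · rw [h, Nat.mod_self]
    · exact Nat.mod_eq_of_lt (by omega)
  rw [h]
  generalize ht : tileAt r a = s
  generalize ht' : tileAt r (if a + 1 = r then 0 else a + 1) = s'
  have key : (s = 2 ∨ s = 6 ∨ s = 11) ∧ (s' = 0 ∨ s' = 3 ∨ s' = 7) ∨ s = 13 ∧ s' = 12 ∨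
      ¬(s = 2 ∨ s = 6 ∨ s = 11) ∧ s ≠ 13 ∧ s' = s + 1 := by
    unfold tileAt at ht ht'
    split_ifs at ht ht' <;> omega
  unfold nextTiles
  rcases key with ⟨h1, h2⟩ | ⟨rfl, rfl⟩ | ⟨h1, h2, rfl⟩
  · simp [h1, h2]
  · simp
  · simp [h1, h2]

/-- Tile `t`, placed `m` positions to the right of tile `s`, is consistent with a packing
colouring. -/
def Compatible (m s t : ℕ) : Prop :=
  ∀ i < 7, ∀ j < 7, ∀ p < 2, ∀ q < 2, tileColour s i p = tileColour t j q →
    (m = 0 ∧ i = j ∧ p = q) ∨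
      tileColour s i p < if m = 0 then (i - j) + (j - i) + ((p - q) + (q - p))
        else (2 * m + q - p) + min (i + j) (12 - (i + j))

set_option synthInstance.maxSize 1000 in
instance (m s t : ℕ) : Decidable (Compatible m s t) := by
  unfold Compatible
  infer_instance

theorem compatible_tiles : ∀ s < 14, Compatible 0 s s ∧ ∀ t ∈ nextTiles s, Compatible 1 s t ∧
    ∀ u ∈ nextTiles t, Compatible 2 s u ∧ ∀ w ∈ nextTiles u, Compatible 3 s w := by
  decide +kernel

theorem tileColour_mem : ∀ s < 14, ∀ i < 7, ∀ q < 2,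
    1 ≤ tileColour s i q ∧ tileColour s i q ≤ 6 := by
  decide +kernel

/-- The tile in position `b` of the periodic arrangement on `ℤ`. -/
def tileSeq (r : ℕ) (b : ℤ) : ℕ := tileAt r (b % r).toNat

theorem tileSeq_succ_mem {r : ℕ} (hr : 2 ≤ r) (b : ℤ) :
    tileSeq r (b + 1) ∈ nextTiles (tileSeq r b) := by
  have h0 := Int.emod_nonneg b (show (r : ℤ) ≠ 0 by omega)
  have hlt := Int.emod_lt_of_pos b (show (0 : ℤ) < r by omega)
  have := tileAt_succ_mem hr (show (b % r).toNat < r by omega)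
  have h : ((b + 1) % r).toNat = ((b % r).toNat + 1) % r := by
    zify
    rw [Int.toNat_of_nonneg (Int.emod_nonneg _ (by omega)), Int.toNat_of_nonneg h0,
      Int.emod_add_emod]
  change tileAt r ((b + 1) % r).toNat ∈ _
  rwa [h]

theorem tileSeq_lt {r : ℕ} (hr : 2 ≤ r) (b : ℤ) : tileSeq r b < 14 := by
  have := Int.emod_lt_of_pos b (show (0 : ℤ) < r by omega)
  exact tileAt_lt (by omega)

theorem compatible_tileSeq {r : ℕ} (hr : 2 ≤ r) (b : ℤ) {m : ℕ} (hm : m ≤ 3) :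
    Compatible m (tileSeq r b) (tileSeq r (b + m)) := by
  obtain ⟨h0, h⟩ := compatible_tiles _ (tileSeq_lt hr b)
  obtain ⟨h1, h⟩ := h _ (tileSeq_succ_mem hr b)
  obtain ⟨h2, h⟩ := h _ (tileSeq_succ_mem hr (b + 1))
  have h3 := h _ (tileSeq_succ_mem hr (b + 1 + 1))
  rw [add_assoc, add_assoc] at h3
  rw [add_assoc] at h2
  interval_cases m
  · simpa using h0
  · exact h1
  · exact h2
  · exact h3

/-- The colour of `(i, x)` in the periodic colouring of the strip. -/
def stripColour (r i : ℕ) (x : ℤ) : ℕ := tileColour (tileSeq r (x / 2)) i (x % 2).toNat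

theorem stripColour_lt_stripDist_of_le {r : ℕ} (hr : 2 ≤ r) {i j : ℕ} (hi : i ≤ 6) (hj : j ≤ 6)
    {x y : ℤ} (hxy : x / 2 ≤ y / 2) (hne : i = j → x ≠ y)
    (h : stripColour r i x = stripColour r j y) :
    (stripColour r i x : ℤ) < stripDist i x j y := by
  have hle := (tileColour_mem _ (tileSeq_lt hr (x / 2)) i (by omega) (x % 2).toNat (by omega)).2
  change stripColour r i x ≤ 6 at hle
  by_cases hm : y / 2 - x / 2 ≤ 3
  · obtain ⟨m, hm'⟩ := Int.eq_ofNat_of_zero_le (sub_nonneg.mpr hxy)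
    have hc := compatible_tileSeq hr (x / 2) (show m ≤ 3 by omega)
    rw [show x / 2 + m = y / 2 by omega] at hc
    have := hc i (by omega) j (by omega) (x % 2).toNat (by omega) (y % 2).toNat (by omega) h
    change _ ∨ stripColour r i x < _ at this
    generalize stripColour r i x = c at *
    simp only [stripDist, abs_eq_max_neg]
    rcases this with ⟨rfl, rfl, h3⟩ | this
    · exact absurd (by omega) (hne rfl)
    · split_ifs at this ⊢ <;> omega
  · rw [stripDist, if_neg (by omega), abs_eq_max_neg]
    omega

theorem stripColour_lt_stripDist {r : ℕ} (hr : 2 ≤ r) {i j : ℕ} (hi : i ≤ 6) (hj : j ≤ 6)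
    {x y : ℤ} (hne : i = j → x ≠ y) (h : stripColour r i x = stripColour r j y) :
    (stripColour r i x : ℤ) < stripDist i x j y := by
  rcases le_total (x / 2) (y / 2) with hxy | hxy
  · exact stripColour_lt_stripDist_of_le hr hi hj hxy hne h
  · have := stripColour_lt_stripDist_of_le hr hj hi hxy (fun h h' => hne h.symm h'.symm) h.symm
    rw [h]
    refine this.trans_le (le_of_eq ?_)
    simp only [stripDist, abs_eq_max_neg]
    split_ifs <;> omega

theorem stripColour_emod {r : ℕ} (i : ℕ) (x : ℤ) :
    stripColour r i (x % (2 * r : ℕ)) = stripColour r i x := by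
  have h := Int.emod_add_mul_ediv x (2 * r : ℕ)
  set y := x % (2 * r : ℕ)
  set q := x / (2 * r : ℕ)
  have hx : x = y + 2 * (r * q) := by rw [← h]; push_cast; ring
  have h1 : x / 2 = y / 2 + r * q := by omega
  have h2 : x % 2 = y % 2 := by omega
  rw [stripColour, stripColour, h1, h2, tileSeq, tileSeq, Int.add_mul_emod_self_left]

theorem isPackingColoring_six {r : ℕ} (hr : 2 ≤ r) :
    IsPackingColoring (genHgraph 5 r) 6 fun v => stripColour r v.1 v.2.val := by
  have : NeZero (2 * r) := ⟨by omega⟩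
  refine ⟨fun v => tileColour_mem _ (tileSeq_lt hr _) _ v.1.isLt _ (by omega), ?_⟩
  intro u v huv hc p
  obtain ⟨y, hy, hle⟩ := exists_stripDist_le_length p (x := u.2.val) (by simp)
  have hval : stripColour r v.1 v.2.val = stripColour r v.1 y := by
    rw [← hy, ZMod.val_intCast, stripColour_emod]
  have := stripColour_lt_stripDist hr (Nat.le_of_lt_succ u.1.isLt) (Nat.le_of_lt_succ v.1.isLt)
    (x := u.2.val) (y := y) (fun h h' => huv (Prod.ext (Fin.ext h) (by rw [← hy, ← h']; simp)))
    (hc.trans hval)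
  exact_mod_cast this.trans_le hle

/-! ### No packing 5-colouring -/

/-- The vertex numbered `v`, when the columns in `cols` are numbered one after the other. -/
def vertexOf (cols : List ℕ) (r v : ℕ) : Fin 7 × ZMod (2 * r) :=
  (⟨v % 7, Nat.mod_lt _ (by norm_num)⟩, (cols.getD (v / 7) 0 : ℕ))

/-- Every edge in `E` joins vertices that are linked in the strip, once columns are taken modulo `m`
(`m = 0` for no reduction). -/
def LinkedEdges (cols : List ℕ) (m : ℕ) (E : List (ℕ × ℕ)) : Prop :=
  ∀ e ∈ E, e.2 < 2 ^ 42 ∧ ∀ v < 42, e.2.testBit v = true →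
    let x := cols.getD (v / 7) 0
    let y := cols.getD ((v + e.1) / 7) 0
    x = y ∧ (v + e.1) % 7 = v % 7 + 1 ∨
    v % 7 = (v + e.1) % 7 ∧
      (y % m = (x + 1) % m ∧ (v % 7 = 0 ∨ v % 7 = 6 ∨ x % 2 = 0) ∨
        x % m = (y + 1) % m ∧ (v % 7 = 0 ∨ v % 7 = 6 ∨ y % 2 = 0))

instance (cols : List ℕ) (m : ℕ) (E : List (ℕ × ℕ)) : Decidable (LinkedEdges cols m E) := by
  unfold LinkedEdges
  infer_instance

theorem adj_vertexOf {cols : List ℕ} {m r : ℕ} {E : List (ℕ × ℕ)} (hr : 2 ≤ r) (hm : 2 * r ∣ m)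
    (h : LinkedEdges cols m E) :
    ∀ e ∈ E, ∀ v, e.2.testBit v = true →
      (genHgraph 5 r).Adj (vertexOf cols r v) (vertexOf cols r (v + e.1)) := by
  have cast_eq : ∀ x y : ℕ, y % m = (x + 1) % m →
      (y : ZMod (2 * r)) = ((x + 1 : ℤ) : ZMod (2 * r)) := by
    intro x y hxy
    have := (ZMod.natCast_eq_natCast_iff y (x + 1) (2 * r)).mpr (Nat.ModEq.of_dvd hm hxy)
    rw [this]
    push_cast
    rfl
  intro e he v hv
  obtain ⟨hlt, h⟩ := h e he
  have hv42 : v < 42 := by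
    by_contra! hge
    rw [Nat.testBit_lt_two_pow (hlt.trans_le (Nat.pow_le_pow_right (by norm_num) hge))] at hv
    exact Bool.false_ne_true hv
  have h := h v hv42 hv
  dsimp only at h
  unfold vertexOf
  generalize cols.getD (v / 7) 0 = x at *
  generalize cols.getD ((v + e.1) / 7) 0 = y at *
  rcases h with ⟨rfl, hi⟩ | ⟨hi, ⟨hxy, h⟩ | ⟨hxy, h⟩⟩
  · simpa using adj_of_stripLink hr (x := x) (x' := x) (.inl ⟨rfl, hi⟩)
  · rw [cast_eq x y hxy]
    simpa using adj_of_stripLink hr (x := x) (x' := x + 1) (.inr ⟨hi, rfl, by dsimp only; omega⟩)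
  · rw [cast_eq y x hxy]
    simpa using (adj_of_stripLink hr (x := y) (x' := y + 1)
      (.inr ⟨hi.symm, rfl, by dsimp only; omega⟩)).symm

theorem vertexOf_injOn {cols : List ℕ} {r N : ℕ} (hN : N = 7 * cols.length) (hcols : cols.Nodup)
    (hlt : ∀ x ∈ cols, x < 2 * r) :
    ∀ u < N, ∀ v < N, vertexOf cols r u = vertexOf cols r v → u = v := by
  intro u hu v hv h
  have hu' : u / 7 < cols.length := by omega
  have hv' : v / 7 < cols.length := by omega
  obtain ⟨h1, h2⟩ := Prod.ext_iff.mp h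
  have h1 : u % 7 = v % 7 := congrArg Fin.val h1
  simp only [vertexOf, List.getD_eq_getElem _ _ hu', List.getD_eq_getElem _ _ hv'] at h2
  rw [ZMod.natCast_eq_natCast_iff', Nat.mod_eq_of_lt (hlt _ (List.getElem_mem hu')),
    Nat.mod_eq_of_lt (hlt _ (List.getElem_mem hv'))] at h2
  have := (hcols.getElem_inj_iff).mp h2
  omega

theorem not_isPackingColoring {r k m : ℕ} (hr : 2 ≤ r) (hk : k ≤ 5) (hm : 2 * r ∣ m)
    {cols : List ℕ} {E : List (ℕ × ℕ)} (hE : LinkedEdges cols m E) (hcols : cols.Nodup)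
    (hlt : ∀ x ∈ cols, x < 2 * r) (hpos : 0 < 7 * cols.length) {n live : ℕ}
    (h : refute E (7 * cols.length) n [0, 0, 0, 0, 0] live = true)
    (π : Fin 7 × ZMod (2 * r) → ℕ) : ¬ IsPackingColoring (genHgraph 5 r) k π := fun hπ =>
  not_excludes_of_refute hπ (adj_vertexOf hr hm hE) (vertexOf_injOn rfl hcols hlt) hpos n _ _ h hk
    (by simp [Excludes])

/-- The edges of `H⁵(2)`. -/
def cycleEdges : List (ℕ × ℕ) := [(1, 133160895), (7, 2089215), (21, 65)]

/-- The edges of three consecutive pairs of columns, the middle pair numbered last. -/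
def pathEdges : List (ℕ × ℕ) := [(1, 2181708111807), (7, 34093383807), (21, 1073280)]

theorem refute_cycleEdges :
    refute cycleEdges 28 29 [0, 0, 0, 0, 0] (2 ^ 28 - 1) = true := by
  decide +kernel

theorem refute_pathEdges :
    refute pathEdges 42 43 [0, 0, 0, 0, 0] (2 ^ 42 - 1) = true := by
  decide +kernel

theorem not_isPackingColoring_of_le_five {r k : ℕ} (hr : 2 ≤ r) (hk : k ≤ 5)
    (π : Fin 7 × ZMod (2 * r) → ℕ) : ¬ IsPackingColoring (genHgraph 5 r) k π := by
  rcases hr.eq_or_lt with rfl | hr'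
  · exact not_isPackingColoring (m := 4) (cols := [0, 1, 2, 3]) le_rfl hk (by norm_num)
      (by decide +kernel) (by decide) (by decide) (by decide) refute_cycleEdges π
  · refine not_isPackingColoring (m := 0) (cols := [0, 1, 4, 5, 2, 3]) hr hk (dvd_zero _)
      (by decide +kernel) (by decide) ?_ (by decide) refute_pathEdges π
    intro x hx
    have : x < 6 := by revert x; decide
    omega

end GenHgraph

theorem packingChromaticNumber_genHgraph_five (r : ℕ) (hr : 2 ≤ r) :
    packingChromaticNumber (genHgraph 5 r) = 6 := by
  refine le_antisymm (Nat.sInf_le ⟨_, GenHgraph.isPackingColoring_six hr⟩) ?_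
  refine le_csInf ⟨6, _, GenHgraph.isPackingColoring_six hr⟩ ?_
  rintro k ⟨π, hπ⟩
  by_contra! hk
  exact GenHgraph.not_isPackingColoring_of_le_five hr (Nat.le_of_lt_succ hk) π hπ
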